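/- For the maximally entangled state ψ₊^d = (1/√d)·Σ_{i} |i⟩ ⊗ |i⟩ on C^d ⊗ C^d (d ≥ 2), the entropic entanglement parameter satisfies M(|ψ₊^d⟩⟨ψ₊^d|) ≥ log₂ d. -/

import Mathlib

open Matrix Kronecker BigOperators ComplexOrder

noncomputable section

namespace EEP

/-- `-(x * log₂ x)`; note `Real.logb 2 0 = 0`, giving the convention `0·log₂ 0 = 0`. -/
def negMulLog2 (x : ℝ) : ℝ := -(x * Real.logb 2 x)

/-- Shannon entropy (base 2) of a finite family of reals. -/
def shannon {n : Type*} [Fintype n] (p : n → ℝ) : ℝ := ∑ i, negMulLog2 (p i)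

/-- A quantum state: positive semidefinite (hence Hermitian) matrix with trace 1. -/
def IsState {n : Type*} [Fintype n] [DecidableEq n] (ρ : Matrix n n ℂ) : Prop :=
  ρ.PosSemidef ∧ ρ.trace = 1

/-- A rank-one orthogonal projection matrix. -/
def IsRankOneProj {n : Type*} [Fintype n] [DecidableEq n] (P : Matrix n n ℂ) : Prop :=
  P.IsHermitian ∧ P * P = P ∧ P.rank = 1

/-- A von Neumann measurement on `C^d ⊗ C^d`: a family of `d²` rank-one orthogonal
projections, mutually orthogonal, summing to the identity. -/
def IsMeasurement {d : ℕ} (P : Fin (d^2) → Matrix (Fin d × Fin d) (Fin d × Fin d) ℂ) : Prop :=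
  (∀ i, IsRankOneProj (P i)) ∧ (∀ i j, i ≠ j → P i * P j = 0) ∧ (∑ i, P i) = 1

/-- Klein entropy: Shannon entropy of the outcome distribution `pᵢ = Tr(ρ Pᵢ)`. -/
def kleinEntropy {d : ℕ} (ρ : Matrix (Fin d × Fin d) (Fin d × Fin d) ℂ)
    (P : Fin (d^2) → Matrix (Fin d × Fin d) (Fin d × Fin d) ℂ) : ℝ :=
  shannon (fun i => (ρ * P i).trace.re)

/-- A product state: Kronecker product of two states on `C^d`. -/
def IsProductState {d : ℕ} (δ : Matrix (Fin d × Fin d) (Fin d × Fin d) ℂ) : Prop :=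
  ∃ σA σB : Matrix (Fin d) (Fin d) ℂ, IsState σA ∧ IsState σB ∧ δ = σA ⊗ₖ σB

/-- Infimum of the Klein entropy over product states, for a fixed measurement. -/
def infProd {d : ℕ} (P : Fin (d^2) → Matrix (Fin d × Fin d) (Fin d × Fin d) ℂ) : ℝ :=
  sInf {x : ℝ | ∃ δ, IsProductState δ ∧ x = kleinEntropy δ P}

/-- The entropic entanglement parameter
`M(ρ) = sup_P ( inf_{δ product} H(δ,P) − H(ρ,P) )`. -/
def eep {d : ℕ} (ρ : Matrix (Fin d × Fin d) (Fin d × Fin d) ℂ) : ℝ :=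
  sSup {x : ℝ | ∃ P, IsMeasurement P ∧ x = infProd P - kleinEntropy ρ P}

/-- A separable state: finite convex combination of product states. -/
def IsSeparable {d : ℕ} (ρ : Matrix (Fin d × Fin d) (Fin d × Fin d) ℂ) : Prop :=
  ∃ (m : ℕ) (p : Fin m → ℝ) (δ : Fin m → Matrix (Fin d × Fin d) (Fin d × Fin d) ℂ),
    (∀ i, 0 ≤ p i) ∧ (∑ i, p i) = 1 ∧ (∀ i, IsProductState (δ i)) ∧
    ρ = ∑ i, (p i : ℂ) • δ i

/-- Rank-one projection `|v⟩⟨v|` onto a vector `v`. -/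
def projVec {n : Type*} (v : n → ℂ) : Matrix n n ℂ := Matrix.vecMulVec v (star v)

/-- Coefficient matrix `A` of a vector `ψ ∈ C^d ⊗ C^d`, `A i j = ψ (i,j)`. -/
def coeffMat {d : ℕ} (ψ : Fin d × Fin d → ℂ) : Matrix (Fin d) (Fin d) ℂ :=
  Matrix.of fun i j => ψ (i, j)

/-- The squared Schmidt coefficients of `ψ`: the eigenvalues of `A Aᴴ`
where `A` is the coefficient matrix of `ψ`. -/
def schmidtSq {d : ℕ} (ψ : Fin d × Fin d → ℂ) : Fin d → ℝ :=
  (Matrix.isHermitian_mul_conjTranspose_self (coeffMat ψ)).eigenvalues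

/-- Largest squared Schmidt coefficient (square of the largest singular value of `A`). -/
def maxSchmidtSq {d : ℕ} (ψ : Fin d × Fin d → ℂ) : ℝ := ⨆ i, schmidtSq ψ i

/-- A unit vector. -/
def IsUnitVec {n : Type*} [Fintype n] (ψ : n → ℂ) : Prop := (∑ p, Complex.normSq (ψ p)) = 1

/-- A maximally entangled unit vector: all squared Schmidt coefficients equal `1/d`. -/
def IsMaxEntVec {d : ℕ} (ψ : Fin d × Fin d → ℂ) : Prop :=
  IsUnitVec ψ ∧ ∀ i, schmidtSq ψ i = 1 / d

/-- A von Neumann measurement in a maximally entangled basis. -/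
def IsMaxEntMeasurement {d : ℕ}
    (P : Fin (d^2) → Matrix (Fin d × Fin d) (Fin d × Fin d) ℂ) : Prop :=
  IsMeasurement P ∧ ∀ i, ∃ ψ, IsMaxEntVec ψ ∧ P i = projVec ψ

/-- Von Neumann entropy: Shannon entropy of the eigenvalues. -/
def vnEntropy {n : Type*} [Fintype n] [DecidableEq n] {ρ : Matrix n n ℂ}
    (h : ρ.IsHermitian) : ℝ := shannon h.eigenvalues

/-- Binary Shannon entropy. -/
def binEnt (x : ℝ) : ℝ := negMulLog2 x + negMulLog2 (1 - x)

lemma exists_char (n : ℕ) : ∃ χ : Fin (n+1) → Fin (n+1) → ℂ,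
    (∀ i, χ 0 i = 1) ∧ (∀ a i, star (χ a i) * χ a i = 1) ∧
    ∀ a b, ∑ i, star (χ a i) * χ b i = if a = b then ((n+1 : ℕ) : ℂ) else 0 := by
  have key : ∃ χ : ZMod (n+1) → ZMod (n+1) → ℂ,
    (∀ i, χ 0 i = 1) ∧ (∀ a i, star (χ a i) * χ a i = 1) ∧
    ∀ a b, ∑ i, star (χ a i) * χ b i = if a = b then ((n+1 : ℕ) : ℂ) else 0 := by
    have hs : ∀ x : ZMod (n+1), star (ZMod.stdAddChar x) = ZMod.stdAddChar (-x) := by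
      intro x
      rw [AddChar.map_neg_eq_conj]; rfl
    refine ⟨fun a i => ZMod.stdAddChar (i * a), ?_, ?_, ?_⟩
    · intro i; simp
    · intro a i
      rw [hs, ← AddChar.map_add_eq_mul]; simp
    · intro a b
      have := AddChar.sum_mulShift (b - a) (ZMod.isPrimitive_stdAddChar (n+1))
      simp only [ZMod.card, sub_eq_zero] at this
      rw [show (if a = b then ((n+1 : ℕ) : ℂ) else 0) = if b = a then ((n+1 : ℕ) : ℂ) else 0 by
        simp [eq_comm]]
      rw [show (if b = a then ((n+1 : ℕ) : ℂ) else 0)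
        = ((if b = a then (n+1 : ℕ) else 0 : ℕ) : ℂ) by split_ifs <;> simp]
      rw [← this]
      refine Finset.sum_congr rfl fun i _ => ?_
      rw [hs, ← AddChar.map_add_eq_mul]
      congr 1; ring
  exact key

lemma exists_bell {d : ℕ} (hd : 2 ≤ d) : ∃ u : Fin (d^2) → (Fin d × Fin d → ℂ),
    (∀ k l, star (u k) ⬝ᵥ u l = if k = l then 1 else 0) ∧
    (∀ k j j', ∑ i, star (u k (i, j)) * u k (i, j') = if j = j' then ((d:ℂ))⁻¹ else 0) ∧
    ∃ k, u k = (fun p : Fin d × Fin d =>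
      if p.1 = p.2 then (((Real.sqrt d)⁻¹ : ℝ) : ℂ) else 0) := by
  obtain ⟨n, rfl⟩ : ∃ n, d = n + 1 := ⟨d - 1, by omega⟩
  obtain ⟨χ, h0, h1, h2⟩ := exists_char n
  let e : Fin ((n+1)^2) ≃ Fin (n+1) × Fin (n+1) :=
    (finCongr (by ring)).trans finProdFinEquiv.symm
  set c : ℂ := (((Real.sqrt (n+1 : ℕ))⁻¹ : ℝ) : ℂ) with hc
  have hcs : star c = c := by rw [hc]; exact Complex.conj_ofReal _
  have hcc : c * c = (((n+1 : ℕ) : ℂ))⁻¹ := by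
    rw [hc, ← Complex.ofReal_mul, ← mul_inv, Real.mul_self_sqrt (by positivity)]
    push_cast; rfl
  have hn : ((n+1 : ℕ) : ℂ) ≠ 0 := by exact_mod_cast Nat.succ_ne_zero n
  let v : Fin (n+1) × Fin (n+1) → (Fin (n+1) × Fin (n+1) → ℂ) := fun k p =>
    if p.2 = p.1 + k.2 then c * χ k.1 p.1 else 0
  refine ⟨fun k => v (e k), ?_, ?_, e.symm (0, 0), ?_⟩
  · have : ∀ k l, star (v k) ⬝ᵥ v l = if k = l then 1 else 0 := by
      rintro ⟨a, b⟩ ⟨a', b'⟩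
      simp only [dotProduct, v, Fintype.sum_prod_type, Pi.star_apply]
      have : ∀ i : Fin (n+1), ∑ j, star (if j = i + b then c * χ a i else 0) *
          (if j = i + b' then c * χ a' i else 0) =
          if b = b' then (c * c) * (star (χ a i) * χ a' i) else 0 := by
        intro i
        rw [Finset.sum_eq_single (i + b)]
        · by_cases h : b = b'
          · subst h; simp only [if_true, star_mul, hcs]; ring
          · simp [h]
        · intro j _ hj; simp [hj]
        · simp
      simp only [this]
      by_cases h : b = b'
      · subst h
        simp only [if_true, ← Finset.mul_sum, h2, hcc]
        by_cases h : a = a'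
        · subst h; simp only [if_true]; exact inv_mul_cancel₀ hn
        · simp [h]
      · simp [h]
    intro k l
    rw [this]; simp [e.injective.eq_iff]
  · intro k j j'
    beta_reduce
    generalize e k = k
    obtain ⟨a, b⟩ := k
    simp only [v]
    rw [Finset.sum_eq_single (j - b)]
    · by_cases h : j = j'
      · subst h
        simp only [sub_add_cancel, if_true, star_mul, hcs]
        rw [← hcc, show star (χ a (j - b)) * c * (c * χ a (j-b))
          = c * c * (star (χ a (j - b)) * χ a (j-b)) by ring, h1, mul_one]
      · simp [h, Ne.symm h]
    · intro i _ hi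
      have : ¬ j = i + b := fun h => hi (by rw [h]; simp)
      simp [this]
    · simp
  · funext p
    simp [v, h0, eq_comm]

lemma projVec_isRankOne {n : Type} [Fintype n] [DecidableEq n] (v : n → ℂ)
    (h : star v ⬝ᵥ v = 1) : IsRankOneProj (projVec v) := by
  refine ⟨?_, ?_, ?_⟩
  · simp [projVec, IsHermitian, conjTranspose_vecMulVec]
  · simp [projVec, vecMulVec_mul_vecMulVec, h]
  · apply le_antisymm (rank_vecMulVec_le _ _)
    by_contra hlt
    have h0 : (projVec v).rank = 0 := by
      have : (projVec v).rank < 1 := not_le.mp hlt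
      omega
    have hz : projVec v = 0 := by
      rw [Matrix.rank, Submodule.finrank_eq_zero, LinearMap.range_eq_bot] at h0
      ext i j
      have := congrFun (congrArg (fun f => f (Pi.single j 1)) h0) i
      simpa using this
    have h3 : (projVec v) *ᵥ v = v := by
      simp [projVec, vecMulVec_mulVec, h]
    rw [hz, zero_mulVec] at h3
    rw [← h3] at h
    simp at h

lemma bell_measurement {d : ℕ} (u : Fin (d^2) → (Fin d × Fin d → ℂ))
    (h : ∀ k l, star (u k) ⬝ᵥ u l = if k = l then 1 else 0) :
    IsMeasurement (fun k => projVec (u k)) := by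
  refine ⟨fun k => projVec_isRankOne _ (by simp [h]), ?_, ?_⟩
  · intro i j hij
    simp [projVec, vecMulVec_mul_vecMulVec, h, hij]
  · let M : Matrix (Fin d × Fin d) (Fin (d^2)) ℂ := Matrix.of fun p k => u k p
    have e : Fin (d^2) ≃ Fin d × Fin d := (finCongr (by ring)).trans finProdFinEquiv.symm
    have h1 : Mᴴ * M = 1 := by
      ext k l
      have := h k l
      simpa [Matrix.mul_apply, M, Matrix.one_apply, dotProduct] using this
    have h2 : M * Mᴴ = 1 := (mul_eq_one_comm_of_equiv e).1 h1
    rw [← h2]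
    ext p q
    simp [Matrix.sum_apply, Matrix.mul_apply, M, projVec, vecMulVec_apply]

lemma prob_nonneg {n : Type*} [Fintype n] [DecidableEq n] {ρ P : Matrix n n ℂ}
    (hρ : ρ.PosSemidef) (hP : IsRankOneProj P) : 0 ≤ (ρ * P).trace.re := by
  have h1 : (ρ * P).trace = (Pᴴ * ρ * P).trace := by
    rw [hP.1.eq, Matrix.mul_assoc, Matrix.trace_mul_comm P, Matrix.mul_assoc, hP.2.1]
  rw [h1]
  exact (Complex.le_def.1 (hρ.conjTranspose_mul_mul_same P).trace_nonneg).1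

lemma prob_sum {d : ℕ} {ρ : Matrix (Fin d × Fin d) (Fin d × Fin d) ℂ}
    {P : Fin (d^2) → Matrix (Fin d × Fin d) (Fin d × Fin d) ℂ}
    (hρ : IsState ρ) (hP : IsMeasurement P) : ∑ i, (ρ * P i).trace.re = 1 := by
  rw [← Complex.re_sum, ← Matrix.trace_sum, ← Matrix.mul_sum, hP.2.2, Matrix.mul_one, hρ.2]
  simp

lemma prob_le_one {d : ℕ} {ρ : Matrix (Fin d × Fin d) (Fin d × Fin d) ℂ}
    {P : Fin (d^2) → Matrix (Fin d × Fin d) (Fin d × Fin d) ℂ}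
    (hρ : IsState ρ) (hP : IsMeasurement P) (i) : (ρ * P i).trace.re ≤ 1 := by
  rw [← prob_sum hρ hP]
  exact Finset.single_le_sum (f := fun i => (ρ * P i).trace.re)
    (fun j _ => prob_nonneg hρ.1 (hP.1 j)) (Finset.mem_univ i)

lemma negMulLog2_nonneg {x : ℝ} (h0 : 0 ≤ x) (h1 : x ≤ 1) : 0 ≤ negMulLog2 x := by
  have := Real.logb_nonpos (b := 2) (by norm_num) h0 h1
  unfold negMulLog2
  nlinarith

lemma negMulLog2_le {x : ℝ} (h0 : 0 ≤ x) : negMulLog2 x ≤ 1 / Real.log 2 := by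
  have hl : 0 < Real.log 2 := Real.log_pos (by norm_num)
  unfold negMulLog2 Real.logb
  rw [← mul_div_assoc, ← neg_div]
  apply div_le_div_of_nonneg_right _ hl.le
  rcases h0.eq_or_lt with rfl | h
  · simp
  · have := Real.one_sub_inv_le_log_of_pos h
    have h2 : x * (1 - x⁻¹) ≤ x * Real.log x := mul_le_mul_of_nonneg_left this h0
    have : x * x⁻¹ = 1 := mul_inv_cancel₀ h.ne'
    nlinarith

lemma klein_nonneg {d : ℕ} {ρ : Matrix (Fin d × Fin d) (Fin d × Fin d) ℂ}
    {P : Fin (d^2) → Matrix (Fin d × Fin d) (Fin d × Fin d) ℂ}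
    (hρ : IsState ρ) (hP : IsMeasurement P) : 0 ≤ kleinEntropy ρ P := by
  unfold kleinEntropy shannon
  exact Finset.sum_nonneg fun i _ =>
    negMulLog2_nonneg (prob_nonneg hρ.1 (hP.1 i)) (prob_le_one hρ hP i)

lemma klein_le {d : ℕ} {ρ : Matrix (Fin d × Fin d) (Fin d × Fin d) ℂ}
    {P : Fin (d^2) → Matrix (Fin d × Fin d) (Fin d × Fin d) ℂ}
    (hρ : IsState ρ) (hP : IsMeasurement P) :
    kleinEntropy ρ P ≤ ∑ _i : Fin (d^2), 1 / Real.log 2 := by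
  unfold kleinEntropy shannon
  exact Finset.sum_le_sum fun i _ => negMulLog2_le (prob_nonneg hρ.1 (hP.1 i))

lemma prod_isState {d : ℕ} {δ : Matrix (Fin d × Fin d) (Fin d × Fin d) ℂ}
    (h : IsProductState δ) : IsState δ := by
  obtain ⟨A, B, hA, hB, rfl⟩ := h
  exact ⟨hA.1.kronecker hB.1, by rw [trace_kronecker, hA.2, hB.2, mul_one]⟩

lemma projVec_isState {n : Type*} [Fintype n] [DecidableEq n] (v : n → ℂ)
    (h : star v ⬝ᵥ v = 1) : IsState (projVec v) :=
  ⟨posSemidef_vecMulVec_self_star v, by rw [projVec, trace_vecMulVec, dotProduct_comm, h]⟩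

lemma exists_prod {d : ℕ} (hd : 2 ≤ d) :
    ∃ δ : Matrix (Fin d × Fin d) (Fin d × Fin d) ℂ, IsProductState δ := by
  have h : IsState (projVec (Pi.single (⟨0, by omega⟩ : Fin d) (1 : ℂ))) :=
    projVec_isState _ (by simp [dotProduct, Pi.single_apply])
  exact ⟨_, _, _, h, h, rfl⟩

lemma one_sub_posSemidef {n : Type*} [Fintype n] [DecidableEq n] {σ : Matrix n n ℂ}
    (h : IsState σ) : (1 - σ).PosSemidef := by
  have hH := h.1.isHermitian
  have htr := hH.trace_eq_sum_eigenvalues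
  rw [h.2] at htr
  have hs : ∑ i, hH.eigenvalues i = 1 := by
    have : ((∑ i, hH.eigenvalues i : ℝ) : ℂ) = 1 := by rw [htr]; push_cast; rfl
    exact_mod_cast this
  have hle : ∀ i, hH.eigenvalues i ≤ 1 := fun i => by
    rw [← hs]
    exact Finset.single_le_sum (fun j _ => h.1.eigenvalues_nonneg j) (Finset.mem_univ i)
  have hD : (diagonal (fun i => ((1 - hH.eigenvalues i : ℝ) : ℂ))).PosSemidef := by
    apply PosSemidef.diagonal
    intro i
    simp only [Pi.zero_apply]
    exact_mod_cast sub_nonneg.2 (hle i)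
  have hU := hD.mul_mul_conjTranspose_same (hH.eigenvectorUnitary : Matrix n n ℂ)
  convert hU using 1
  conv_lhs => rw [hH.spectral_theorem]
  rw [Unitary.conjStarAlgAut_apply]
  have h1 : (diagonal (fun i => ((1 - hH.eigenvalues i : ℝ) : ℂ))) =
      1 - diagonal (RCLike.ofReal ∘ hH.eigenvalues) := by
    rw [← diagonal_one, diagonal_sub]
    congr 1; funext i; simp
  have h2 : (hH.eigenvectorUnitary : Matrix n n ℂ) * (hH.eigenvectorUnitary : Matrix n n ℂ)ᴴ = 1 :=
    Unitary.coe_mul_star_self _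
  rw [h1, Matrix.mul_sub, Matrix.sub_mul, Matrix.mul_one, h2]
  rfl

lemma trace_projVec {n : Type*} [Fintype n] (ρ : Matrix n n ℂ) (v : n → ℂ) :
    (ρ * projVec v).trace = star v ⬝ᵥ (ρ *ᵥ v) := by
  rw [projVec, mul_vecMulVec, trace_vecMulVec, dotProduct_comm]

lemma prod_prob_le {d : ℕ} {δ : Matrix (Fin d × Fin d) (Fin d × Fin d) ℂ}
    (h : IsProductState δ) (u : Fin d × Fin d → ℂ)
    (hu : ∀ j j', ∑ i, star (u (i, j)) * u (i, j') = if j = j' then ((d:ℂ))⁻¹ else 0) :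
    (δ * projVec u).trace.re ≤ (d:ℝ)⁻¹ := by
  obtain ⟨A, B, hA, hB, rfl⟩ := h
  have hps := ((one_sub_posSemidef hA).kronecker hB.1).dotProduct_mulVec_nonneg u
  have hsub : (1 - A) ⊗ₖ B = (1 : Matrix (Fin d) (Fin d) ℂ) ⊗ₖ B - A ⊗ₖ B := by
    ext p q; simp [sub_mul]
  rw [hsub, Matrix.sub_mulVec, dotProduct_sub] at hps
  have h1 : star u ⬝ᵥ (((1 : Matrix (Fin d) (Fin d) ℂ) ⊗ₖ B) *ᵥ u) = (d:ℂ)⁻¹ := by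
    have : star u ⬝ᵥ (((1 : Matrix (Fin d) (Fin d) ℂ) ⊗ₖ B) *ᵥ u)
        = ∑ j, ∑ j', B j j' * ∑ i, star (u (i, j)) * u (i, j') := by
      simp only [dotProduct, mulVec, Fintype.sum_prod_type, kroneckerMap_apply, Matrix.one_apply,
        Pi.star_apply, ite_mul, one_mul, zero_mul, Finset.mul_sum]
      rw [Finset.sum_comm]
      refine Finset.sum_congr rfl fun j _ => ?_
      rw [Finset.sum_comm (s := Finset.univ (α := Fin d)) (t := Finset.univ)
        (f := fun j' i => B j j' * (star (u (i, j)) * u (i, j')))]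
      refine Finset.sum_congr rfl fun i _ => ?_
      rw [Finset.sum_eq_single i]
      · refine Finset.sum_congr rfl fun j' _ => ?_
        simp; ring
      · intro b _ hb; simp [Ne.symm hb]
      · simp
    rw [this]
    simp only [hu, mul_ite, mul_zero, Finset.sum_ite_eq, Finset.mem_univ, if_true,
      ← Finset.sum_mul]
    have := hB.2
    rw [Matrix.trace] at this
    simp only [Matrix.diag_apply] at this
    rw [this, one_mul]
  rw [h1] at hps
  rw [trace_projVec]
  have := (Complex.le_def.1 hps).1
  simp only [Complex.zero_re, Complex.sub_re] at this
  have h3 : ((d:ℂ)⁻¹).re = (d:ℝ)⁻¹ := by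
    rw [← Complex.ofReal_natCast, ← Complex.ofReal_inv, Complex.ofReal_re]
  rw [h3] at this
  linarith

lemma negMulLog2_ge {d : ℕ} (hd : 2 ≤ d) {x : ℝ} (h0 : 0 ≤ x) (h1 : x ≤ (d:ℝ)⁻¹) :
    x * Real.logb 2 d ≤ negMulLog2 x := by
  unfold negMulLog2
  rcases h0.eq_or_lt with rfl | h
  · simp
  · have := Real.logb_le_logb_of_le (b := 2) (by norm_num) h h1
    rw [Real.logb_inv] at this
    nlinarith

/-- For the maximally entangled state ψ₊^d = (1/√d) Σᵢ |i⟩⊗|i⟩ (d ≥ 2),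
M(|ψ₊^d⟩⟨ψ₊^d|) ≥ log₂ d. -/
theorem stmt17 {d : ℕ} (hd : 2 ≤ d) :
    Real.logb 2 d ≤ eep (projVec (fun p : Fin d × Fin d =>
      if p.1 = p.2 then (((Real.sqrt d)⁻¹ : ℝ) : ℂ) else 0)) := by
  obtain ⟨u, hu, hu2, k0, hk0⟩ := exists_bell hd
  rw [← hk0]
  have hst : IsState (projVec (u k0)) := projVec_isState _ (by simp [hu])
  have hM := bell_measurement u hu
  obtain ⟨δ0, hδ0⟩ := exists_prod hd
  have hK : kleinEntropy (projVec (u k0)) (fun k => projVec (u k)) = 0 := by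
    unfold kleinEntropy shannon
    refine Finset.sum_eq_zero fun i _ => ?_
    simp only [trace_projVec]
    simp only [projVec, vecMulVec_mulVec, hu]
    by_cases h : k0 = i
    · subst h; simp [negMulLog2, hu]
    · simp [negMulLog2, h]
  have hI : Real.logb 2 d ≤ infProd (fun k => projVec (u k)) := by
    refine le_csInf ⟨_, δ0, hδ0, rfl⟩ ?_
    rintro x ⟨δ, hδ, rfl⟩
    have hs := prob_sum (prod_isState hδ) hM
    calc Real.logb 2 d = (∑ i, (δ * projVec (u i)).trace.re) * Real.logb 2 d := by
          rw [hs, one_mul]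
      _ ≤ _ := by
          unfold kleinEntropy shannon
          rw [Finset.sum_mul]
          exact Finset.sum_le_sum fun i _ => negMulLog2_ge hd
            (prob_nonneg (prod_isState hδ).1 (hM.1 i)) (prod_prob_le hδ _ (hu2 i))
  refine le_trans ?_ (le_csSup ?_ ⟨_, hM, rfl⟩)
  · rw [hK]; linarith
  · refine ⟨∑ _i : Fin (d^2), 1 / Real.log 2, ?_⟩
    rintro x ⟨P, hP, rfl⟩
    have h1 : infProd P ≤ kleinEntropy δ0 P := by
      refine csInf_le ⟨0, ?_⟩ ⟨δ0, hδ0, rfl⟩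
      rintro y ⟨δ, hδ, rfl⟩
      exact klein_nonneg (prod_isState hδ) hP
    have h2 := klein_le (prod_isState hδ0) hP
    have h3 := klein_nonneg hst hP
    linarith

end EEP
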